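/- Let p be the unique root in (0,1) of p³ = (1−p)². Then τ := Σ_{k=1}^∞ k·(H·F_{k−1})′(p)/2^{k+1} > 0, where (H·F_{k−1})′(p) denotes the derivative of x ↦ H(x)F_{k−1}(x) at x = p. -/

import Mathlib

open scoped Classical

noncomputable section

/-- Binary entropy function `H(r) = -r log₂ r - (1-r) log₂ (1-r)`. -/
def Hent (r : ℝ) : ℝ := -r * Real.logb 2 r - (1 - r) * Real.logb 2 (1 - r)

/-- The polynomials `F₀(x) = 1`, `F₁(x) = 1 + x`,
`F_k(x) = 1 + x F_{k-1}(x) + (1-x) F_{k-2}(x)` for `k ≥ 2`. -/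
def Fpoly : ℕ → ℝ → ℝ
  | 0, _ => 1
  | 1, x => 1 + x
  | (k + 2), x => 1 + x * Fpoly (k + 1) x + (1 - x) * Fpoly k x

theorem Fpoly_eq {x : ℝ} (hx : 2 - x ≠ 0) :
    ∀ k : ℕ, Fpoly k x = (k + 2) / (2 - x) - 1 / (2 - x) ^ 2
      + (1 - x) ^ 2 * (x - 1) ^ k / (2 - x) ^ 2
  | 0 => by simp only [Fpoly]; field_simp; push_cast; ring
  | 1 => by simp only [Fpoly]; field_simp; push_cast; ring
  | k + 2 => by
    rw [Fpoly, Fpoly_eq hx (k + 1), Fpoly_eq hx k]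
    field_simp
    push_cast
    ring

/-- The value of the derivative of `Fpoly k` away from `x = 2`. -/
def FpolyDeriv (k : ℕ) (x : ℝ) : ℝ :=
  (k + 2) / (2 - x) ^ 2 - 2 / (2 - x) ^ 3
    - (1 - x) * (k + 2) * (x - 1) ^ k / (2 - x) ^ 2
    + 2 * (1 - x) ^ 2 * (x - 1) ^ k / (2 - x) ^ 3

theorem hasDerivAt_Fpoly {x : ℝ} (hx : 2 - x ≠ 0) :
    ∀ k : ℕ, HasDerivAt (Fpoly k) (FpolyDeriv k x) x
  | 0 => by
    have h : FpolyDeriv 0 x = 0 := by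
      simp only [FpolyDeriv]; field_simp; push_cast; ring
    rw [h]
    exact hasDerivAt_const x 1
  | 1 => by
    have h : FpolyDeriv 1 x = 1 := by
      simp only [FpolyDeriv]; field_simp; push_cast; ring
    rw [h]
    exact (hasDerivAt_id x).const_add 1
  | k + 2 => by
    have h := (((hasDerivAt_id x).mul (hasDerivAt_Fpoly hx (k + 1))).const_add 1).add
      (((hasDerivAt_id x).const_sub 1).mul (hasDerivAt_Fpoly hx k))
    refine h.congr_deriv ?_
    simp only [Fpoly_eq hx, FpolyDeriv, id]
    field_simp
    push_cast
    ring

theorem hasDerivAt_Hent {x : ℝ} (hx : 0 < x) (hx1 : x < 1) :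
    HasDerivAt Hent ((Real.log (1 - x) - Real.log x) / Real.log 2) x := by
  have hx1' : 1 - x ≠ 0 := by linarith
  have hsub : HasDerivAt (fun y : ℝ => 1 - y) (-1) x := (hasDerivAt_id x).const_sub 1
  have h := (((hasDerivAt_id x).neg.mul (Real.hasDerivAt_log hx.ne')).sub
    (hsub.mul (hsub.log hx1'))).div_const (Real.log 2)
  refine (h.congr_deriv ?_).congr_of_eventuallyEq (.of_forall fun y => ?_)
  · simp only [id, Pi.neg_apply]
    field_simp
    ring
  · simp only [Hent, Real.logb, id, Pi.sub_apply, Pi.mul_apply, Pi.neg_apply]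
    ring

theorem hasSum_succ_mul_geometric {w : ℝ} (hw : ‖w‖ < 1) :
    HasSum (fun k : ℕ => (k + 1 : ℝ) * w ^ k) (1 / (1 - w) ^ 2) := by
  simpa using hasSum_choose_mul_geometric_of_norm_lt_one 1 hw

theorem hasSum_succ_mul_succ_succ_mul_geometric {w : ℝ} (hw : ‖w‖ < 1) :
    HasSum (fun k : ℕ => (k + 1 : ℝ) * (k + 2) * w ^ k) (2 / (1 - w) ^ 3) := by
  have h := (hasSum_choose_mul_geometric_of_norm_lt_one 2 hw).mul_left 2
  rw [mul_one_div] at h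
  refine h.congr_fun fun k => ?_
  rw [Nat.cast_choose_two]
  push_cast
  ring

theorem hasSum_succ_mul_Fpoly {x : ℝ} (hx : 0 < x) (hx1 : x < 1) :
    HasSum (fun k : ℕ => (k + 1 : ℝ) * Fpoly k x / 2 ^ (k + 2))
      (4 * (4 - x) / (3 - x) ^ 2) := by
  have hw : ‖(1 / 2 : ℝ)‖ < 1 := by norm_num
  have hv : ‖(x - 1) / 2‖ < 1 := by rw [Real.norm_eq_abs, abs_lt]; constructor <;> linarith
  have h2 : 2 - x ≠ 0 := by linarith
  have h3 : 3 - x ≠ 0 := by linarith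
  have h := (((hasSum_succ_mul_succ_succ_mul_geometric hw).mul_left (1 / (4 * (2 - x)))).sub
    ((hasSum_succ_mul_geometric hw).mul_left (1 / (4 * (2 - x) ^ 2)))).add
    ((hasSum_succ_mul_geometric hv).mul_left ((1 - x) ^ 2 / (4 * (2 - x) ^ 2)))
  convert h using 1
  · rfl
  · funext k
    rw [Fpoly_eq h2, div_pow, div_pow, one_pow]
    field_simp
    ring
  · rw [show 1 - (x - 1) / 2 = (3 - x) / 2 by ring]
    field_simp
    ring

theorem hasSum_succ_mul_FpolyDeriv {x : ℝ} (hx : 0 < x) (hx1 : x < 1) :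
    HasSum (fun k : ℕ => (k + 1 : ℝ) * FpolyDeriv k x / 2 ^ (k + 2))
      (4 * (5 - x) / (3 - x) ^ 3) := by
  have hw : ‖(1 / 2 : ℝ)‖ < 1 := by norm_num
  have hv : ‖(x - 1) / 2‖ < 1 := by rw [Real.norm_eq_abs, abs_lt]; constructor <;> linarith
  have h2 : 2 - x ≠ 0 := by linarith
  have h3 : 3 - x ≠ 0 := by linarith
  have h := ((((hasSum_succ_mul_succ_succ_mul_geometric hw).mul_left
      (1 / (4 * (2 - x) ^ 2))).sub
    ((hasSum_succ_mul_geometric hw).mul_left (2 / (4 * (2 - x) ^ 3)))).sub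
    ((hasSum_succ_mul_succ_succ_mul_geometric hv).mul_left ((1 - x) / (4 * (2 - x) ^ 2)))).add
    ((hasSum_succ_mul_geometric hv).mul_left (2 * (1 - x) ^ 2 / (4 * (2 - x) ^ 3)))
  convert h using 1
  · rfl
  · funext k
    rw [FpolyDeriv, div_pow, div_pow, one_pow]
    field_simp
    ring
  · rw [show 1 - (x - 1) / 2 = (3 - x) / 2 by ring]
    field_simp
    ring

/-- With `p ∈ (0,1)` the root of `p³ = (1-p)²`:
`τ = ∑_{k≥1} k (H·F_{k-1})'(p) / 2^{k+1} > 0` (sum reindexed by `k ↦ k+1`). -/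
theorem tau_pos (p : ℝ) (hp : p ∈ Set.Ioo (0 : ℝ) 1) (hpe : p ^ 3 = (1 - p) ^ 2) :
    0 < ∑' k : ℕ, (k + 1 : ℝ) * deriv (fun x => Hent x * Fpoly k x) p / 2 ^ (k + 2) := by
  obtain ⟨hp0, hp1⟩ := hp
  have h2 : 2 - p ≠ 0 := by linarith
  have h3 : 0 < 3 - p := by linarith
  have hlog2 : 0 < Real.log 2 := Real.log_pos one_lt_two
  have hlog : Real.log p < 0 := Real.log_neg hp0 hp1
  have hlogq : Real.log (1 - p) = 3 / 2 * Real.log p := by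
    have h := congrArg Real.log hpe
    rw [Real.log_pow, Real.log_pow] at h
    push_cast at h
    linarith
  have hderiv (k : ℕ) : deriv (fun x => Hent x * Fpoly k x) p =
      (Real.log (1 - p) - Real.log p) / Real.log 2 * Fpoly k p + Hent p * FpolyDeriv k p :=
    ((hasDerivAt_Hent hp0 hp1).mul (hasDerivAt_Fpoly h2 k)).deriv
  have hsum := ((hasSum_succ_mul_Fpoly hp0 hp1).mul_left
    ((Real.log (1 - p) - Real.log p) / Real.log 2)).add
    ((hasSum_succ_mul_FpolyDeriv hp0 hp1).mul_left (Hent p))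
  have hsum' : HasSum
      (fun k : ℕ => (k + 1 : ℝ) * deriv (fun x => Hent x * Fpoly k x) p / 2 ^ (k + 2))
      (2 * -Real.log p / (Real.log 2 * (3 - p) ^ 2)) := by
    convert hsum using 1
    · rfl
    · funext k
      rw [hderiv]
      ring
    · rw [Hent, Real.logb, Real.logb, hlogq]
      field_simp
      ring
  rw [hsum'.tsum_eq]
  have := neg_pos.mpr hlog
  positivity

end
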